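/- Let n ≥ 1 and let Γ be a finite subgroup of O(n) satisfying the standing hypotheses (a), (b), (c). Then there exist an integer m ≥ 1, isotropy semiaxes L₁, …, L_m and isotropy planes P₁, …, P_m of Γ such that: (1) for all i ≠ j there is no γ ∈ Γ with γ·L_i = L_j, and no γ ∈ Γ with γP_i = P_j; (2) for every j = 2, …, m the intersection P_{j−1} ∩ P_j is a one-dimensional subspace and L_j ⊆ P_{j−1} ∩ P_j; (3) there exists γ ∈ Γ such that P_m ∩ γP₁ is a one-dimensional subspace and L₁ ⊆ P_m ∩ γP₁. -/

import Mathlib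

noncomputable section

/-- `ℝⁿ` as a Euclidean space. -/
abbrev Vn (n : ℕ) := EuclideanSpace ℝ (Fin n)

/-- The orthogonal group `O(n)`, realized as linear isometric self-equivalences of `ℝⁿ`. -/
abbrev On (n : ℕ) := Vn n ≃ₗᵢ[ℝ] Vn n

/-- `Fix(S) = {x : σ x = x for all σ ∈ S}`. -/
def FixSet {n : ℕ} (S : Subgroup (On n)) : Set (Vn n) :=
  {x | ∀ σ ∈ S, σ x = x}

/-- An isotropy plane of `Γ`: a two-dimensional subspace of the form `Fix(Σ)`
for a subgroup `Σ ≤ Γ`. -/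
def IsIsotropyPlane {n : ℕ} (Γ : Subgroup (On n)) (P : Submodule ℝ (Vn n)) : Prop :=
  Module.finrank ℝ P = 2 ∧ ∃ S : Subgroup (On n), S ≤ Γ ∧ (P : Set (Vn n)) = FixSet S

/-- The ray (open semiaxis) spanned by `v`. -/
def ray {n : ℕ} (v : Vn n) : Set (Vn n) := {x | ∃ t : ℝ, 0 < t ∧ x = t • v}

/-- An isotropy semiaxis of `Γ`: a ray `{t v : t > 0}`, `v ≠ 0`, whose spanned line `ℝ v`
equals `Fix(Δ)` for some subgroup `Δ ≤ Γ`. -/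
def IsIsotropySemiaxis {n : ℕ} (Γ : Subgroup (On n)) (L : Set (Vn n)) : Prop :=
  ∃ v : Vn n, v ≠ 0 ∧ L = ray v ∧ ∃ Δ : Subgroup (On n), Δ ≤ Γ ∧
    ((Submodule.span ℝ {v} : Submodule ℝ (Vn n)) : Set (Vn n)) = FixSet Δ

/-- The isotropy subgroup `Δ_L = {γ ∈ Γ : γ x = x for all x ∈ L}` of a semiaxis `L`. -/
def semiaxisStab {n : ℕ} (Γ : Subgroup (On n)) (L : Set (Vn n)) : Subgroup (On n) where
  carrier := {γ | γ ∈ Γ ∧ ∀ x ∈ L, γ x = x}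
  one_mem' := ⟨Γ.one_mem, fun x _ => rfl⟩
  mul_mem' := by
    rintro a b ⟨ha, ha'⟩ ⟨hb, hb'⟩
    refine ⟨Γ.mul_mem ha hb, fun x hx => ?_⟩
    show a (b x) = x
    rw [hb' x hx, ha' x hx]
  inv_mem' := by
    rintro a ⟨ha, ha'⟩
    refine ⟨Γ.inv_mem ha, fun x hx => ?_⟩
    show a.symm x = x
    conv_lhs => rw [← ha' x hx]
    exact a.symm_apply_apply x

/-- A subspace `W` is invariant under a subgroup `Δ`. -/
def Invariant {n : ℕ} (Δ : Subgroup (On n)) (W : Submodule ℝ (Vn n)) : Prop :=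
  ∀ δ ∈ Δ, ∀ x ∈ W, δ x ∈ W

/-- Two (`Δ`-invariant) subspaces `W₁`, `W₂` are isomorphic as real representations of `Δ`:
there is a linear equivalence intertwining the `Δ`-actions. -/
def RepIso {n : ℕ} (Δ : Subgroup (On n)) (W₁ W₂ : Submodule ℝ (Vn n)) : Prop :=
  ∃ e : W₁ ≃ₗ[ℝ] W₂, ∀ δ ∈ Δ, ∀ x y : W₁, (y : Vn n) = δ (x : Vn n) →
    ((e y : Vn n) = δ ((e x : Vn n)))

/-- A semiaxis `L` is simple: `ℝⁿ` decomposes into `n` one-dimensional `Δ_L`-invariant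
subspaces that are pairwise non-isomorphic as real representations of `Δ_L`. -/
def IsSimpleSemiaxis {n : ℕ} (Γ : Subgroup (On n)) (L : Set (Vn n)) : Prop :=
  ∃ ℓ : Fin n → Submodule ℝ (Vn n), DirectSum.IsInternal ℓ ∧
    (∀ i, Module.finrank ℝ (ℓ i) = 1) ∧
    (∀ i, Invariant (semiaxisStab Γ L) (ℓ i)) ∧
    Pairwise fun i j => ¬ RepIso (semiaxisStab Γ L) (ℓ i) (ℓ j)

open scoped RealInnerProductSpace

/-- unit vectors spanning an isotropy line -/
def Ax {n : ℕ} (Γ : Subgroup (On n)) (v : Vn n) : Prop :=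
  ‖v‖ = 1 ∧ ∃ Δ : Subgroup (On n), Δ ≤ Γ ∧
    ((Submodule.span ℝ {v} : Submodule ℝ (Vn n)) : Set (Vn n)) = FixSet Δ

theorem ax_semiaxis {n : ℕ} {Γ : Subgroup (On n)} {v : Vn n} (h : Ax Γ v) :
    IsIsotropySemiaxis Γ (ray v) := by
  refine ⟨v, ?_, rfl, h.2⟩
  rintro rfl
  simpa using h.1

theorem ax_neg {n : ℕ} {Γ : Subgroup (On n)} {v : Vn n} (h : Ax Γ v) : Ax Γ (-v) := by
  obtain ⟨h1, D, hD, h2⟩ := h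
  refine ⟨by simpa using h1, D, hD, ?_⟩
  rw [← h2, ← Set.neg_singleton, Submodule.span_neg]

theorem mem_ray_self {n : ℕ} (v : Vn n) : v ∈ ray v := ⟨1, one_pos, by simp⟩

theorem ray_unit_eq {n : ℕ} {v w : Vn n} (hv : ‖v‖ = 1) (hw : ‖w‖ = 1) (h : v ∈ ray w) :
    v = w := by
  obtain ⟨t, ht, rfl⟩ := h
  rw [norm_smul, hw, mul_one, Real.norm_eq_abs, abs_of_pos ht] at hv
  simp [hv]

theorem exists_ax {n : ℕ} {Γ : Subgroup (On n)} (hb : ∃ L, IsIsotropySemiaxis Γ L) :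
    ∃ v, Ax Γ v := by
  obtain ⟨L, v, hv, -, D, hD, h⟩ := hb
  refine ⟨‖v‖⁻¹ • v, ?_, D, hD, ?_⟩
  · rw [norm_smul, norm_inv, norm_norm, inv_mul_cancel₀ (norm_ne_zero_iff.2 hv)]
  · rw [← h, Submodule.span_singleton_smul_eq]
    exact (inv_ne_zero (norm_ne_zero_iff.2 hv)).isUnit

theorem ax_finite {n : ℕ} {Γ : Subgroup (On n)} (hfin : (Γ : Set (On n)).Finite) :
    {v | Ax Γ v}.Finite := by
  have h1 : (𝒫 (Γ : Set (On n))).Finite := hfin.finite_subsets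
  refine Set.Finite.subset (h1.biUnion (t := fun A => {v : Vn n | ‖v‖ = 1 ∧
    ((Submodule.span ℝ {v} : Submodule ℝ (Vn n)) : Set (Vn n)) = {x | ∀ σ ∈ A, σ x = x}}) ?_) ?_
  · intro A _
    rcases Set.eq_empty_or_nonempty {v : Vn n | ‖v‖ = 1 ∧
      ((Submodule.span ℝ {v} : Submodule ℝ (Vn n)) : Set (Vn n)) = {x | ∀ σ ∈ A, σ x = x}} with h | ⟨w, hw⟩
    · rw [h]; exact Set.finite_empty
    · refine Set.Finite.subset (Set.toFinite {w, -w}) ?_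
      rintro v ⟨hv1, hv2⟩
      have : v ∈ Submodule.span ℝ {w} := by
        rw [← SetLike.mem_coe, hw.2, ← hv2]
        exact Submodule.mem_span_singleton_self v
      obtain ⟨t, rfl⟩ := Submodule.mem_span_singleton.1 this
      rw [norm_smul, hw.1, mul_one, Real.norm_eq_abs] at hv1
      rcases (abs_eq zero_le_one).1 hv1 with h | h
      · left; simp [h]
      · right; simp [h]
  · rintro v ⟨hv, D, hD, h⟩
    simp only [Set.mem_iUnion]
    exact ⟨(D : Set (On n)), hD, hv, h⟩

theorem plane_basis {n : ℕ} {P : Submodule ℝ (Vn n)} (hP : Module.finrank ℝ P = 2) {v : Vn n}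
    (hvP : v ∈ P) (hv : ‖v‖ = 1) :
    ∃ e ∈ P, ‖e‖ = 1 ∧ ⟪v, e⟫ = 0 ∧ ∀ x ∈ P, x = ⟪v, x⟫ • v + ⟪e, x⟫ • e := by
  have hvv : ⟪v, v⟫ = 1 := by rw [real_inner_self_eq_norm_sq, hv]; norm_num
  have h0 : ∃ y ∈ P, y ∉ Submodule.span ℝ {v} := by
    by_contra! hcon
    have h1 := Submodule.finrank_mono (show P ≤ Submodule.span ℝ {v} from hcon)
    have h2 := finrank_span_le_card (R := ℝ) ({v} : Set (Vn n))
    simp at h2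
    omega
  obtain ⟨y, hy, hyv⟩ := h0
  set f := y - ⟪v, y⟫ • v with hf
  have hf0 : f ≠ 0 := by
    intro h
    apply hyv
    rw [sub_eq_zero.1 h]
    exact Submodule.smul_mem _ _ (Submodule.mem_span_singleton_self v)
  have hfP : f ∈ P := P.sub_mem hy (P.smul_mem _ hvP)
  have hvf : ⟪v, f⟫ = 0 := by
    rw [hf, inner_sub_right, inner_smul_right, hvv]; ring
  have he1 : ‖‖f‖⁻¹ • f‖ = 1 := by
    rw [norm_smul, norm_inv, norm_norm, inv_mul_cancel₀ (norm_ne_zero_iff.2 hf0)]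
  have hve : ⟪v, ‖f‖⁻¹ • f⟫ = 0 := by rw [inner_smul_right, hvf, mul_zero]
  have heP : ‖f‖⁻¹ • f ∈ P := P.smul_mem _ hfP
  generalize ‖f‖⁻¹ • f = e at he1 hve heP
  have hee : ⟪e, e⟫ = 1 := by rw [real_inner_self_eq_norm_sq, he1]; norm_num
  have hev : ⟪e, v⟫ = 0 := by rw [real_inner_comm, hve]
  refine ⟨e, heP, he1, hve, ?_⟩
  have hon : Orthonormal ℝ ![v, e] := by
    constructor
    · intro i; fin_cases i <;> simp [hv, he1]
    · intro i j hij
      fin_cases i <;> fin_cases j <;> simp_all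
  have hli := hon.linearIndependent
  have hspan : Submodule.span ℝ (Set.range ![v, e]) = P := by
    apply Submodule.eq_of_le_of_finrank_eq
    · rw [Submodule.span_le]
      rintro _ ⟨i, rfl⟩
      fin_cases i <;> simp [hvP, heP]
    · rw [finrank_span_eq_card hli, hP]; simp
  intro x hx
  rw [← hspan] at hx
  have : x ∈ Submodule.span ℝ {v, e} := by simpa [Set.pair_comm] using hx
  obtain ⟨a, b, rfl⟩ := Submodule.mem_span_pair.1 this
  simp only [inner_add_right, inner_smul_right, hvv, hve, hee, hev]
  simp

theorem finrank_inter {n : ℕ} {P Q : Submodule ℝ (Vn n)} (hP : Module.finrank ℝ P = 2)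
    (hQ : Module.finrank ℝ Q = 2) (hne : P ≠ Q) {v : Vn n} (hv : v ≠ 0) (h1 : v ∈ P) (h2 : v ∈ Q) :
    Module.finrank ℝ ↥(P ⊓ Q) = 1 := by
  have a1 : Module.finrank ℝ ↥(P ⊓ Q) ≤ 2 := hP ▸ Submodule.finrank_mono inf_le_left
  have a2 : Module.finrank ℝ ↥(P ⊓ Q) ≠ 2 := by
    intro h
    have b1 : P ⊓ Q = P := Submodule.eq_of_le_of_finrank_eq inf_le_left (by omega)
    have b2 : P ⊓ Q = Q := Submodule.eq_of_le_of_finrank_eq inf_le_right (by omega)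
    exact hne (b1.symm.trans b2)
  have a3 : Module.finrank ℝ ↥(P ⊓ Q) ≠ 0 := by
    intro h
    rw [Submodule.finrank_eq_zero] at h
    have : v ∈ P ⊓ Q := ⟨h1, h2⟩
    rw [h] at this
    exact hv (by simpa using this)
  omega

theorem iso_inner {n : ℕ} (g : On n) (x y : Vn n) : ⟪g x, g y⟫ = ⟪x, y⟫ := g.inner_map_map x y

/-- reflection lemma -/
theorem refl_exists {n : ℕ} {Γ : Subgroup (On n)}
    (ha : ∀ L : Set (Vn n), IsIsotropySemiaxis Γ L → IsSimpleSemiaxis Γ L)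
    {P : Submodule ℝ (Vn n)} (hP : IsIsotropyPlane Γ P) {v : Vn n} (hv : Ax Γ v) (hvP : v ∈ P) :
    ∃ δ ∈ Γ, ∀ x ∈ P, δ x = (2 * ⟪v, x⟫) • v - x := by
  obtain ⟨l, hl, hl1, hli, -⟩ := ha _ (ax_semiaxis hv)
  set D := semiaxisStab Γ (ray v) with hD
  have hDv : ∀ δ ∈ D, δ v = v := fun δ hδ => hδ.2 v (mem_ray_self v)
  have hDmem : ∀ δ ∈ Γ, δ v = v → δ ∈ D := by
    rintro δ hδ h
    refine ⟨hδ, ?_⟩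
    rintro x ⟨t, -, rfl⟩
    rw [map_smul, h]
  -- commutativity
  have hscal : ∀ δ ∈ D, ∀ i, ∃ c : ℝ, ∀ x ∈ l i, δ x = c • x := by
    intro δ hδ i
    obtain ⟨b, hb, hb'⟩ := finrank_eq_one_iff'.1 (hl1 i)
    obtain ⟨c, hc⟩ := hb' ⟨δ b, hli i δ hδ b b.2⟩
    have hc' : c • (b : Vn n) = δ b := congrArg Subtype.val hc
    refine ⟨c, fun x hx => ?_⟩
    obtain ⟨d, hd⟩ := hb' ⟨x, hx⟩
    have hd' : d • (b : Vn n) = x := congrArg Subtype.val hd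
    rw [← hd', map_smul, ← hc', smul_comm]
  have hcomm : ∀ δ ∈ D, ∀ σ ∈ D, ∀ x, δ (σ x) = σ (δ x) := by
    intro δ hδ σ hσ x
    have hx : x ∈ iSup l := by rw [hl.submodule_iSup_eq_top]; trivial
    refine Submodule.iSup_induction l (motive := fun x => δ (σ x) = σ (δ x)) hx ?_ ?_ ?_
    · intro i x hx
      obtain ⟨c, hc⟩ := hscal δ hδ i
      obtain ⟨d, hd⟩ := hscal σ hσ i
      rw [hc x hx, hd x hx, map_smul, map_smul, hc x hx, hd x hx, smul_comm]
    · simp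
    · intro x y hx hy
      simp only [map_add, hx, hy]
  obtain ⟨hP2, S, hS, hPS⟩ := hP
  have hmemP : ∀ x, x ∈ P ↔ ∀ σ ∈ S, σ x = x := by
    intro x; rw [← SetLike.mem_coe, hPS]; rfl
  have hSD : ∀ σ ∈ S, σ ∈ D := fun σ hσ => hDmem σ (hS hσ) ((hmemP v).1 hvP σ hσ)
  have hDP : ∀ δ ∈ D, ∀ x ∈ P, δ x ∈ P := by
    intro δ hδ x hx
    rw [hmemP]
    intro σ hσ
    rw [← hcomm δ hδ σ (hSD σ hσ), (hmemP x).1 hx σ hσ]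
  obtain ⟨e, heP, he1, hve, hb⟩ := plane_basis hP2 hvP hv.1
  have hvv : ⟪v, v⟫ = 1 := by rw [real_inner_self_eq_norm_sq, hv.1]; norm_num
  have hee : ⟪e, e⟫ = 1 := by rw [real_inner_self_eq_norm_sq, he1]; norm_num
  have hpm : ∀ δ ∈ D, δ e = e ∨ δ e = -e := by
    intro δ hδ
    have h1 := hb (δ e) (hDP δ hδ e heP)
    have h2 : ⟪v, δ e⟫ = 0 := by
      rw [← hve, ← iso_inner δ v e, hDv δ hδ]
    rw [h2, zero_smul, zero_add] at h1
    have h3 : ‖δ e‖ = 1 := by rw [δ.norm_map, he1]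
    rw [h1, norm_smul, he1, mul_one, Real.norm_eq_abs] at h3
    rcases (abs_eq zero_le_one).1 h3 with h | h
    · left; rw [h1, h, one_smul]
    · right; rw [h1, h, neg_one_smul]
  have hex : ∃ δ ∈ D, δ e ≠ e := by
    by_contra! hcon
    obtain ⟨-, D', hD', hfix⟩ := hv
    have hfix' : ∀ x, x ∈ Submodule.span ℝ {v} ↔ ∀ σ ∈ D', σ x = x := by
      intro x; rw [← SetLike.mem_coe, hfix]; rfl
    have : e ∈ Submodule.span ℝ {v} := by
      rw [hfix']
      intro σ hσ
      exact hcon σ (hDmem σ (hD' hσ) ((hfix' v).1 (Submodule.mem_span_singleton_self v) σ hσ))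
    obtain ⟨t, rfl⟩ := Submodule.mem_span_singleton.1 this
    rw [inner_smul_right, hvv, mul_one] at hve
    simp [hve] at he1
  obtain ⟨δ, hδ, hne⟩ := hex
  have hδe := (hpm δ hδ).resolve_left hne
  refine ⟨δ, hδ.1, fun x hx => ?_⟩
  conv_lhs => rw [hb x hx]
  rw [map_add, map_smul, map_smul, hDv δ hδ, hδe]
  conv_rhs => rw [hb x hx]
  simp only [inner_add_right, inner_smul_right, hvv, hve]
  module

/-- a vector of an isotropy plane fixed by an element which does not fix the plane -/
theorem ax_of_fixed {n : ℕ} {Γ : Subgroup (On n)} {P : Submodule ℝ (Vn n)}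
    (hP : IsIsotropyPlane Γ P) {μ : On n} (hμ : μ ∈ Γ) {z : Vn n} (hzP : z ∈ P) (hz : ‖z‖ = 1)
    (hμz : μ z = z) {y : Vn n} (hy : y ∈ P) (hμy : μ y ≠ y) : Ax Γ z := by
  obtain ⟨hP2, S, hS, hPS⟩ := hP
  have hmemP : ∀ x, x ∈ P ↔ ∀ σ ∈ S, σ x = x := by
    intro x; rw [← SetLike.mem_coe, hPS]; rfl
  obtain ⟨e, heP, he1, hve, hb⟩ := plane_basis hP2 hzP hz
  refine ⟨hz, Subgroup.closure (insert μ (S : Set (On n))), ?_, ?_⟩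
  · rw [Subgroup.closure_le]
    exact Set.insert_subset hμ hS
  · ext x
    constructor
    · intro hx σ hσ
      obtain ⟨t, rfl⟩ := Submodule.mem_span_singleton.1 hx
      rw [map_smul]
      congr 1
      induction hσ using Subgroup.closure_induction with
      | mem σ h =>
        rcases h with rfl | h
        · exact hμz
        · exact (hmemP z).1 hzP σ h
      | one => rfl
      | mul a b _ _ h1 h2 => 
        show a (b z) = z
        rw [h2, h1]
      | inv a _ h =>
        show a.symm z = z
        conv_lhs => rw [← h]
        exact a.symm_apply_apply z
    · intro hx
      have hxP : x ∈ P := (hmemP x).2 fun σ hσ =>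
        hx σ (Subgroup.subset_closure (Set.mem_insert_of_mem _ hσ))
      have hxμ : μ x = x := hx μ (Subgroup.subset_closure (Set.mem_insert _ _))
      have h1 := hb x hxP
      by_cases h0 : ⟪e, x⟫ = 0
      · rw [h0, zero_smul, add_zero] at h1
        rw [h1]
        exact Submodule.smul_mem _ _ (Submodule.mem_span_singleton_self z)
      · exfalso
        have he : μ e = e := by
          rw [h1, map_add, map_smul, map_smul, hμz] at hxμ
          have h2 := add_left_cancel hxμ
          exact smul_right_injective _ h0 h2
        apply hμy
        rw [hb y hy, map_add, map_smul, map_smul, hμz, he]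

theorem arith_aux {a b c s : ℝ} (h1 : a ^ 2 + b ^ 2 = 1) (h2 : c ^ 2 + s ^ 2 = 1) (hs : 0 ≤ s)
    (hb : 0 ≤ b) (hac : a ≤ c) (hc : c < 1) (h3 : 2 * (a * c + b * s) * c - a ≤ a) :
    a = c ∧ b = s := by
  rcases hs.eq_or_lt with rfl | hs
  · have hc1 : c = -1 := by
      have : (c - 1) * (c + 1) = 0 := by nlinarith
      rcases mul_eq_zero.1 this with h | h <;> linarith
    have ha : a = -1 := by nlinarith
    subst hc1 ha
    exact ⟨rfl, by nlinarith⟩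
  · have h4 : b * c ≤ a * s := by
      have : s * (b * c) ≤ s * (a * s) := by nlinarith
      exact le_of_mul_le_mul_left this hs
    have hca : c ≤ a := by
      rcases le_or_gt 0 a with ha | ha
      · by_contra! h
        have : s < b := by nlinarith
        nlinarith
      · by_contra! h
        have hc0 : c < 0 := by
          by_contra! h0
          nlinarith [mul_nonneg hb h0, mul_neg_of_neg_of_pos ha hs]
        have : b < s := by nlinarith
        nlinarith
    have e : a = c := le_antisymm hac hca
    subst e
    refine ⟨rfl, ?_⟩
    have : (b - s) * (b + s) = 0 := by nlinarith
    rcases mul_eq_zero.1 this with h | h <;> linarith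

theorem ax_conj_aux {n : ℕ} {Γ : Subgroup (On n)} {g : On n} (hg : g ∈ Γ) {v : Vn n} (hv : Ax Γ v) :
    Ax Γ (g v) := by
  obtain ⟨h1, D, hD, h⟩ := hv
  have hmem : ∀ x, x ∈ Submodule.span ℝ {v} ↔ ∀ σ ∈ D, σ x = x := by
    intro x; rw [← SetLike.mem_coe, h]; rfl
  refine ⟨by rw [g.norm_map, h1], D.map (MulAut.conj g).toMonoidHom, ?_, ?_⟩
  · rintro _ ⟨σ, hσ, rfl⟩
    exact Γ.mul_mem (Γ.mul_mem hg (hD hσ)) (Γ.inv_mem hg)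
  · ext x
    have key : x ∈ Submodule.span ℝ {g v} ↔ g.symm x ∈ Submodule.span ℝ {v} := by
      simp only [Submodule.mem_span_singleton]
      constructor
      · rintro ⟨a, rfl⟩
        exact ⟨a, by rw [map_smul, g.symm_apply_apply]⟩
      · rintro ⟨a, ha⟩
        exact ⟨a, by rw [← map_smul, ha, g.apply_symm_apply]⟩
    rw [SetLike.mem_coe, key, hmem]
    constructor
    · rintro h _ ⟨σ, hσ, rfl⟩
      show g (σ (g.symm x)) = x
      rw [h σ hσ, g.apply_symm_apply]
    · intro h σ hσ
      have : g (σ (g.symm x)) = x := h _ ⟨σ, hσ, rfl⟩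
      rw [← g.symm_apply_apply (σ (g.symm x)), this]

theorem plane_two {n : ℕ} {Γ : Subgroup (On n)} (hfin : (Γ : Set (On n)).Finite)
    {P : Submodule ℝ (Vn n)} (hP : IsIsotropyPlane Γ P)
    (hrefl : ∀ v, Ax Γ v → v ∈ P → ∃ δ ∈ Γ, ∀ x ∈ P, δ x = (2 * ⟪v, x⟫) • v - x)
    {u : Vn n} (hu : Ax Γ u) (huP : u ∈ P) :
    ∃ w ∈ P, Ax Γ w ∧ (∀ γ ∈ Γ, (∀ x ∈ P, γ x ∈ P) → γ u ≠ w) ∧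
      ∀ x ∈ P, Ax Γ x → ∃ γ ∈ Γ, γ x = u ∨ γ x = w := by
  have huu : ⟪u, u⟫ = 1 := by rw [real_inner_self_eq_norm_sq, hu.1]; norm_num
  have hu0 : u ≠ 0 := by rintro rfl; simp at huu
  have hnu : -u ≠ u := by
    intro h
    have h1 : ⟪u, -u⟫ = ⟪u, u⟫ := by rw [h]
    rw [inner_neg_right, huu] at h1
    norm_num at h1
  obtain ⟨w, ⟨hw, hwP, hwu⟩, hmax⟩ := Set.exists_max_image {x | Ax Γ x ∧ x ∈ P ∧ x ≠ u}
    (fun x => ⟪u, x⟫) ((ax_finite hfin).subset fun x hx => hx.1)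
    ⟨-u, ax_neg hu, P.neg_mem huP, hnu⟩
  have hww : ⟪w, w⟫ = 1 := by rw [real_inner_self_eq_norm_sq, hw.1]; norm_num
  -- basis with w in the upper half plane
  obtain ⟨e, heP, he1, hue, hb, hs⟩ : ∃ e ∈ P, ‖e‖ = 1 ∧ ⟪u, e⟫ = 0 ∧
      (∀ x ∈ P, x = ⟪u, x⟫ • u + ⟪e, x⟫ • e) ∧ 0 ≤ ⟪e, w⟫ := by
    obtain ⟨e, heP, he1, hue, hb⟩ := plane_basis hP.1 huP hu.1
    rcases le_total 0 ⟪e, w⟫ with h | h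
    · exact ⟨e, heP, he1, hue, hb, h⟩
    · refine ⟨-e, P.neg_mem heP, by simpa using he1, by simp [hue], ?_, by simpa using h⟩
      intro x hx
      simpa using hb x hx
  have hee : ⟪e, e⟫ = 1 := by rw [real_inner_self_eq_norm_sq, he1]; norm_num
  have heu : ⟪e, u⟫ = 0 := by rw [real_inner_comm, hue]
  have hinner : ∀ x ∈ P, ∀ y ∈ P, ⟪x, y⟫ = ⟪u, x⟫ * ⟪u, y⟫ + ⟪e, x⟫ * ⟪e, y⟫ := by
    intro x hx y hy
    conv_lhs => rw [hb x hx]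
    rw [inner_add_left, inner_smul_left, inner_smul_left]
    simp
  have hcs : ⟪u, w⟫ ^ 2 + ⟪e, w⟫ ^ 2 = 1 := by
    rw [← hww, hinner w hwP w hwP]; ring
  have hwb := hb w hwP
  set c := ⟪u, w⟫ with hc
  set s := ⟪e, w⟫ with hsdef
  have hc1 : c < 1 := by
    have h1 : c ≤ 1 := by nlinarith [sq_nonneg s]
    refine lt_of_le_of_ne h1 fun h => hwu ?_
    have : s = 0 := by
      rw [h] at hcs
      nlinarith
    rw [hwb, h, this]; simp
  refine ⟨w, hwP, hw, ?_, ?_⟩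
  · intro ν hν hνP hνu
    obtain ⟨δ, hδ, hδr⟩ := hrefl u hu huP
    have hδu : δ u = u := by rw [hδr u huP, huu]; module
    have hδe : δ e = -e := by rw [hδr e heP, hue]; module
    -- get the reflection
    obtain ⟨μ, hμ, hμu, hμe⟩ : ∃ μ ∈ Γ, μ u = c • u + s • e ∧ μ e = s • u - c • e := by
      have h1 := hb (ν e) (hνP e heP)
      have h2 : ⟪w, ν e⟫ = 0 := by rw [← hνu, iso_inner, hue]
      have h3 : ⟪ν e, ν e⟫ = 1 := by rw [iso_inner, hee]
      rw [hinner w hwP _ (hνP e heP), ← hc, ← hsdef] at h2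
      rw [hinner _ (hνP e heP) _ (hνP e heP)] at h3
      generalize ⟪u, ν e⟫ = p at *
      generalize ⟪e, ν e⟫ = q at *
      -- c p + s q = 0, p^2+q^2 = 1
      have h4 : (p * s - q * c) * (p * s - q * c) = 1 := by
        have : (c * p + s * q) ^ 2 + (p * s - q * c) ^ 2 = (c ^ 2 + s ^ 2) * (p * p + q * q) := by
          ring
        rw [h2, hcs, h3] at this
        linarith
      have e1 : p = s * (p * s - q * c) := by linear_combination c * h2 - p * hcs
      have e2 : q = - c * (p * s - q * c) := by linear_combination s * h2 - q * hcs
      rcases mul_self_eq_one_iff.1 h4 with h | h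
      · refine ⟨ν, hν, by rw [hνu, hwb], ?_⟩
        rw [h] at e1 e2
        rw [h1, e1, e2]; module
      · refine ⟨ν * δ, Γ.mul_mem hν hδ, ?_, ?_⟩
        · show ν (δ u) = _
          rw [hδu, hνu, hwb]
        · show ν (δ e) = _
          rw [h] at e1 e2
          rw [hδe, map_neg, h1, e1, e2]; module
    rcases hs.eq_or_lt with h0 | hspos
    · have hcm : c = -1 := by
        have : (c - 1) * (c + 1) = 0 := by rw [← h0] at hcs; nlinarith
        rcases mul_eq_zero.1 this with h | h <;> linarith
      have hμe' : μ e = e := by rw [hμe, ← h0, hcm]; module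
      have hμu' : μ u ≠ u := by
        rw [hμu, ← h0, hcm]
        intro h
        exact hnu (by simpa using h)
      have := hmax e ⟨ax_of_fixed hP hμ heP he1 hμe' huP hμu', heP, by
        rintro rfl; rw [huu] at hue; norm_num at hue⟩
      simp only [hue] at this
      linarith
    · have hzP : u + w ∈ P := P.add_mem huP hwP
      have hk : ‖u + w‖ ^ 2 = 2 + 2 * c := by
        rw [← real_inner_self_eq_norm_sq, inner_add_left, inner_add_right, inner_add_right,
          huu, hww, real_inner_comm u w, ← hc]; ring
      have hcgt : -1 < c := by
        by_contra! h
        nlinarith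
      have hkpos : 0 < ‖u + w‖ := by
        refine lt_of_le_of_ne (norm_nonneg _) fun h => ?_
        rw [← h] at hk
        linarith [hk]
      have hμw : μ w = u := by
        rw [hwb, map_add, map_smul, map_smul, hμu, hμe]
        have : c • (c • u + s • e) + s • (s • u - c • e) = (c ^ 2 + s ^ 2) • u := by module
        rw [this, hcs, one_smul]
      have hμu2 : μ u = w := by rw [hμu, hwb]
      set k := ‖u + w‖ with hkd
      have hzfix : μ (k⁻¹ • (u + w)) = k⁻¹ • (u + w) := by
        rw [map_smul, map_add, hμw, hμu2, add_comm]
      have hz1 : ‖k⁻¹ • (u + w)‖ = 1 := by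
        rw [norm_smul, norm_inv, hkd, norm_norm, inv_mul_cancel₀ hkpos.ne']
      have hiz : ⟪u, k⁻¹ • (u + w)⟫ = k / 2 := by
        rw [inner_smul_right, inner_add_right, huu, ← hc]
        field_simp
        linarith
      have := hmax (k⁻¹ • (u + w)) ⟨ax_of_fixed hP hμ (P.smul_mem _ hzP) hz1 hzfix huP
        (by rw [hμu2]; exact hwu), P.smul_mem _ hzP, by
          intro h
          rw [h] at hzfix
          exact hwu (hμu2.symm.trans hzfix)⟩
      simp only [hiz] at this
      nlinarith
  · intro x hxP hx
    -- maximise over conjugates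
    obtain ⟨x', ⟨⟨γ, hγ, hγx⟩, hx'P⟩, hmax'⟩ := Set.exists_max_image
      {y | (∃ γ ∈ Γ, γ x = y) ∧ y ∈ P}
      (fun y => ⟪u, y⟫) ((ax_finite hfin).subset (by
        rintro _ ⟨⟨γ, hγ, rfl⟩, -⟩; exact ax_conj_aux hγ hx))
      ⟨x, ⟨1, Γ.one_mem, rfl⟩, hxP⟩
    obtain ⟨y, ⟨γ, hγ, hγx⟩, hyP, hyu, hys⟩ : ∃ y, (∃ γ ∈ Γ, γ x = y) ∧ y ∈ P ∧
        ⟪u, y⟫ = ⟪u, x'⟫ ∧ 0 ≤ ⟪e, y⟫ := by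
      rcases le_total 0 ⟪e, x'⟫ with h | h
      · exact ⟨x', ⟨γ, hγ, hγx⟩, hx'P, rfl, h⟩
      · obtain ⟨δ, hδ, hδr⟩ := hrefl u hu huP
        refine ⟨δ x', ⟨δ * γ, Γ.mul_mem hδ hγ, ?_⟩, ?_, ?_, ?_⟩
        · show δ (γ x) = _
          rw [hγx]
        · rw [hδr _ hx'P]
          exact P.sub_mem (P.smul_mem _ huP) hx'P
        · rw [hδr _ hx'P, inner_sub_right, inner_smul_right, huu]; ring
        · rw [hδr _ hx'P, inner_sub_right, inner_smul_right, heu]; linarith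
    refine ⟨γ, hγ, ?_⟩
    rw [hγx]
    by_cases hne : y = u
    · exact Or.inl hne
    right
    have hyA : Ax Γ y := hγx ▸ ax_conj_aux hγ hx
    have hyc : ⟪u, y⟫ ≤ c := hmax y ⟨hyA, hyP, hne⟩
    obtain ⟨δ, hδ, hδr⟩ := hrefl w hw hwP
    have h3 := hmax' (δ y) ⟨⟨δ * γ, Γ.mul_mem hδ hγ, by show δ (γ x) = _; rw [hγx]⟩, by
      rw [hδr _ hyP]
      exact P.sub_mem (P.smul_mem _ hwP) hyP⟩
    simp only [← hyu] at h3
    rw [hδr _ hyP, inner_sub_right, inner_smul_right, hinner w hwP y hyP, ← hc, ← hsdef] at h3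
    have hyy : ⟪u, y⟫ ^ 2 + ⟪e, y⟫ ^ 2 = 1 := by
      have : ⟪y, y⟫ = 1 := by rw [real_inner_self_eq_norm_sq, hyA.1]; norm_num
      rw [← this, hinner y hyP y hyP]; ring
    have := arith_aux hyy hcs hs hys hyc hc1 (by linarith)
    rw [hb y hyP, this.1, this.2, ← hwb]

theorem finrank_map_on {n : ℕ} (g : On n) (P : Submodule ℝ (Vn n)) :
    Module.finrank ℝ (P.map (g.toLinearEquiv : Vn n →ₗ[ℝ] Vn n)) = Module.finrank ℝ P :=
  LinearEquiv.finrank_map_eq g.toLinearEquiv P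

theorem ray_sub {n : ℕ} {v : Vn n} {P : Submodule ℝ (Vn n)} (h : v ∈ P) :
    ray v ⊆ (P : Set (Vn n)) := by
  rintro _ ⟨t, -, rfl⟩
  exact P.smul_mem t h

theorem ray_image {n : ℕ} {g : On n} {v w : Vn n} (hv : ‖v‖ = 1) (hw : ‖w‖ = 1)
    (h : ⇑g '' ray v = ray w) : g v = w := by
  refine ray_unit_eq (by rw [g.norm_map, hv]) hw ?_
  rw [← h]
  exact ⟨v, mem_ray_self v, rfl⟩

/-- Under the standing hypotheses (a), (b), (c), a finite subgroup `Γ ≤ O(n)`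
possesses sequences of isotropy semiaxes `L₁, …, L_m` and isotropy planes `P₁, …, P_m` with:
(1) no two of the `L_j` (resp. `P_j`) are related by an element of `Γ`;
(2) for `j = 2, …, m`, `P_{j-1} ∩ P_j` is one-dimensional and `L_j ⊆ P_{j-1} ∩ P_j`;
(3) for some `γ ∈ Γ`, `P_m ∩ γ P₁` is one-dimensional and `L₁ ⊆ P_m ∩ γ P₁`. -/
theorem statement1 {n : ℕ} (hn : 1 ≤ n) (Γ : Subgroup (On n))
    (hfin : (Γ : Set (On n)).Finite)
    (ha : ∀ L : Set (Vn n), IsIsotropySemiaxis Γ L → IsSimpleSemiaxis Γ L)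
    (hb : ∃ L : Set (Vn n), IsIsotropySemiaxis Γ L)
    (hc : ∀ L : Set (Vn n), IsIsotropySemiaxis Γ L →
      ∃ P P' : Submodule ℝ (Vn n), IsIsotropyPlane Γ P ∧ IsIsotropyPlane Γ P' ∧ P ≠ P' ∧
        L ⊆ (P : Set (Vn n)) ∧ L ⊆ (P' : Set (Vn n))) :
    ∃ m : ℕ, 1 ≤ m ∧ ∃ (L : ℕ → Set (Vn n)) (P : ℕ → Submodule ℝ (Vn n)),
      (∀ j, 1 ≤ j → j ≤ m → IsIsotropySemiaxis Γ (L j) ∧ IsIsotropyPlane Γ (P j)) ∧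
      (∀ i j, 1 ≤ i → i ≤ m → 1 ≤ j → j ≤ m → i ≠ j →
        (∀ γ ∈ Γ, ⇑γ '' L i ≠ L j) ∧
        (∀ γ ∈ Γ, (P i).map (γ.toLinearEquiv : Vn n →ₗ[ℝ] Vn n) ≠ P j)) ∧
      (∀ j, 2 ≤ j → j ≤ m →
        Module.finrank ℝ ↥(P (j - 1) ⊓ P j) = 1 ∧
        L j ⊆ ((P (j - 1) ⊓ P j : Submodule ℝ (Vn n)) : Set (Vn n))) ∧
      (∃ γ ∈ Γ,
        Module.finrank ℝ
          ↥(P m ⊓ (P 1).map (γ.toLinearEquiv : Vn n →ₗ[ℝ] Vn n)) = 1 ∧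
        L 1 ⊆ ((P m ⊓ (P 1).map (γ.toLinearEquiv : Vn n →ₗ[ℝ] Vn n) :
          Submodule ℝ (Vn n)) : Set (Vn n))) := by
  classical
  have hrefl := fun (P : Submodule ℝ (Vn n)) (hP : IsIsotropyPlane Γ P) (v : Vn n) (hv : Ax Γ v)
    (hvP : v ∈ P) => refl_exists ha hP hv hvP
  have hne0 : ∀ v, Ax Γ v → v ≠ 0 := by
    rintro _ h rfl
    simpa using h.1
  by_cases hno : ∃ P, IsIsotropyPlane Γ P ∧ ∃ v, Ax Γ v ∧ v ∈ P ∧ ∃ γ ∈ Γ,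
      v ∈ P.map (γ.toLinearEquiv : Vn n →ₗ[ℝ] Vn n) ∧
      P ≠ P.map (γ.toLinearEquiv : Vn n →ₗ[ℝ] Vn n)
  · obtain ⟨P, hP, v, hv, hvP, γ, hγ, hvg, hne⟩ := hno
    refine ⟨1, le_rfl, fun _ => ray v, fun _ => P, ?_, ?_, ?_, γ, hγ, ?_, ?_⟩
    · exact fun _ _ _ => ⟨ax_semiaxis hv, hP⟩
    · intro i j h1 h2 h3 h4 h5
      omega
    · intro j h1 h2
      omega
    · exact finrank_inter hP.1 ((finrank_map_on γ P).trans hP.1) hne (hne0 v hv) hvP hvg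
    · exact ray_sub (Submodule.mem_inf.2 ⟨hvP, hvg⟩)
  · push Not at hno
    -- one step of the walk
    have hplane : ∀ (P : Submodule ℝ (Vn n)) (v : Vn n), Ax Γ v →
        ∃ P', IsIsotropyPlane Γ P' ∧ v ∈ P' ∧ P' ≠ P := by
      intro P v hv
      obtain ⟨Q, Q', hQ, hQ', hne, h1, h2⟩ := hc _ (ax_semiaxis hv)
      by_cases h : Q = P
      · exact ⟨Q', hQ', h2 (mem_ray_self v), fun h' => hne (h.trans h'.symm)⟩
      · exact ⟨Q, hQ, h1 (mem_ray_self v), h⟩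
    let St := {q : Vn n × Submodule ℝ (Vn n) // Ax Γ q.1 ∧ IsIsotropyPlane Γ q.2 ∧ q.1 ∈ q.2}
    have hstep : ∀ q : St, ∃ q' : St, q'.1.1 ∈ q.1.2 ∧ q'.1.2 ≠ q.1.2 ∧
        (∀ γ ∈ Γ, γ q.1.1 ≠ q'.1.1) ∧
        (∀ x ∈ q.1.2, Ax Γ x → ∃ γ ∈ Γ, γ x = q.1.1 ∨ γ x = q'.1.1) := by
      rintro ⟨⟨v, P⟩, hv, hP, hvP⟩
      dsimp only at hv hP hvP
      obtain ⟨w, hwP, hw, h1, h2⟩ := plane_two hfin hP (hrefl P hP) hv hvP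
      obtain ⟨P', hP', hwP', hne⟩ := hplane P w hw
      refine ⟨⟨(w, P'), hw, hP', hwP'⟩, hwP, hne, ?_, h2⟩
      intro γ hγ h
      refine h1 γ hγ ?_ h
      have h3 := hno P hP w hw hwP γ hγ ⟨v, hvP, h⟩
      intro x hx
      rw [h3]
      exact ⟨x, hx, rfl⟩
    choose nx hnx1 hnx2 hnx3 hnx4 using hstep
    obtain ⟨v0, hv0⟩ := exists_ax hb
    obtain ⟨P0, hP0, hvP0, -⟩ := hplane ⊥ v0 hv0
    let q : ℕ → St := fun k => nx^[k] ⟨(v0, P0), hv0, hP0, hvP0⟩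
    have hq : ∀ k, q (k + 1) = nx (q k) := fun k => Function.iterate_succ_apply' _ _ _
    obtain ⟨v, Q, hv, hQ, hvQ, hs1, hs2, hs3, hs4⟩ : ∃ (v : ℕ → Vn n)
        (Q : ℕ → Submodule ℝ (Vn n)), (∀ k, Ax Γ (v k)) ∧ (∀ k, IsIsotropyPlane Γ (Q k)) ∧
        (∀ k, v k ∈ Q k) ∧ (∀ k, v (k + 1) ∈ Q k) ∧ (∀ k, Q (k + 1) ≠ Q k) ∧
        (∀ k, ∀ γ ∈ Γ, γ (v k) ≠ v (k + 1)) ∧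
        (∀ k, ∀ x ∈ Q k, Ax Γ x → ∃ γ ∈ Γ, γ x = v k ∨ γ x = v (k + 1)) := by
      refine ⟨fun k => (q k).1.1, fun k => (q k).1.2, fun k => (q k).2.1, fun k => (q k).2.2.1,
        fun k => (q k).2.2.2, ?_, ?_, ?_, ?_⟩
      · intro k; simp only [hq]; exact hnx1 _
      · intro k; simp only [hq]; exact hnx2 _
      · intro k; simp only [hq]; exact hnx3 _
      · intro k; simp only [hq]; exact hnx4 _
    clear_value q
    -- conjugacy
    let C : Vn n → Vn n → Prop := fun x y => ∃ γ ∈ Γ, γ x = y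
    have Csymm : ∀ {x y}, C x y → C y x := by
      rintro x y ⟨γ, hγ, rfl⟩
      exact ⟨γ⁻¹, Γ.inv_mem hγ, γ.symm_apply_apply x⟩
    have Ctrans : ∀ {x y z}, C x y → C y z → C x z := by
      rintro x y z ⟨γ, hγ, rfl⟩ ⟨δ, hδ, rfl⟩
      exact ⟨δ * γ, Γ.mul_mem hδ hγ, rfl⟩
    have hmapsymm : ∀ {A B : Submodule ℝ (Vn n)} {γ : On n}, γ ∈ Γ →
        A.map (γ.toLinearEquiv : Vn n →ₗ[ℝ] Vn n) = B →
        ∃ δ ∈ Γ, B.map (δ.toLinearEquiv : Vn n →ₗ[ℝ] Vn n) = A := by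
      rintro A B γ hγ rfl
      refine ⟨γ⁻¹, Γ.inv_mem hγ, ?_⟩
      ext x
      constructor
      · rintro ⟨_, ⟨y, hy, rfl⟩, rfl⟩
        have : (γ⁻¹ : On n) (γ y) = y := γ.symm_apply_apply y
        exact this.symm ▸ hy
      · intro hx
        exact ⟨γ x, ⟨x, hx, rfl⟩, γ.symm_apply_apply x⟩
    -- pigeonhole and minimal return
    have hex : ∃ d, 0 < d ∧ ∃ i, C (v i) (v (i + d)) := by
      have : ¬ Function.Injective v := by
        intro hinj
        have := Set.infinite_range_of_injective hinj
        exact this ((ax_finite hfin).subset (by rintro _ ⟨k, rfl⟩; exact hv k))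
      simp only [Function.Injective, not_forall] at this
      obtain ⟨i, j, hij, hne⟩ := this
      rcases lt_or_gt_of_ne hne with h | h
      · exact ⟨j - i, by omega, i, 1, Γ.one_mem, by
          rw [show i + (j - i) = j by omega]; exact hij⟩
      · exact ⟨i - j, by omega, j, 1, Γ.one_mem, by
          rw [show j + (i - j) = i by omega]; exact hij.symm⟩
    obtain ⟨d, ⟨hd0, i, hi⟩, hmin⟩ : ∃ d, (0 < d ∧ ∃ i, C (v i) (v (i + d))) ∧
        ∀ a b, a < b → b < a + d → ¬ C (v a) (v b) := by
      refine ⟨Nat.find hex, Nat.find_spec hex, ?_⟩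
      intro a b hab hbd hC
      refine Nat.find_min hex (m := b - a) (by omega) ⟨by omega, a, ?_⟩
      rw [show a + (b - a) = b by omega]
      exact hC
    have hcons : ∀ k, ∀ γ ∈ Γ, (Q k).map (γ.toLinearEquiv : Vn n →ₗ[ℝ] Vn n) ≠ Q (k + 1) := by
      intro k γ hγ h
      refine hs2 k ?_
      rw [← h]
      exact (hno (Q k) (hQ k) (v (k + 1)) (hv _) (hs1 k) γ hγ (h ▸ hvQ (k + 1))).symm
    have hd2 : 2 ≤ d := by
      by_contra! h
      have : d = 1 := by omega
      subst this
      obtain ⟨γ, hγ, h⟩ := hi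
      exact hs3 i γ hγ h
    -- planes are pairwise nonconjugate
    have hplanes : ∀ a b, i ≤ a → a < b → b < i + d → ∀ γ ∈ Γ,
        (Q a).map (γ.toLinearEquiv : Vn n →ₗ[ℝ] Vn n) ≠ Q b := by
      intro a b hia hab hbd γ hγ h
      have h1 : ∀ x, Ax Γ x → x ∈ Q a → C x (v b) ∨ C x (v (b + 1)) := by
        intro x hx hxa
        obtain ⟨δ, hδ, h'⟩ := hs4 b (γ x) (h ▸ ⟨x, hxa, rfl⟩) (ax_conj_aux hγ hx)
        have : C x (γ x) := ⟨γ, hγ, rfl⟩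
        rcases h' with h' | h'
        · exact Or.inl (Ctrans this ⟨δ, hδ, h'⟩)
        · exact Or.inr (Ctrans this ⟨δ, hδ, h'⟩)
      have h2 : C (v a) (v (b + 1)) :=
        (h1 _ (hv a) (hvQ a)).resolve_left (hmin a b hab (by omega))
      have h3 : ¬ C (v (a + 1)) (v (b + 1)) := by
        intro h'
        obtain ⟨γ, hγ, h⟩ := Ctrans h2 (Csymm h')
        exact hs3 a γ hγ h
      have h4 := (h1 _ (hv (a + 1)) (hs1 a)).resolve_right h3
      by_cases h5 : b = a + 1
      · subst h5
        exact hcons a γ hγ h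
      · exact hmin (a + 1) b (by omega) (by omega) h4
    let w : ℕ → Vn n := fun t => if t = 1 then v (i + d) else v (i + t - 1)
    have hw1 : w 1 = v (i + d) := if_pos rfl
    have hwt : ∀ t, t ≠ 1 → w t = v (i + t - 1) := fun t ht => if_neg ht
    have hwA : ∀ t, Ax Γ (w t) := by
      intro t
      by_cases h : t = 1
      · rw [h, hw1]; exact hv _
      · rw [hwt t h]; exact hv _
    have hwC : ∀ t, C (v (i + t - 1)) (w t) := by
      intro t
      by_cases h : t = 1
      · rw [h, hw1]; exact hi
      · rw [hwt t h]; exact ⟨1, Γ.one_mem, rfl⟩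
    clear_value w
    refine ⟨d, hd0, fun t => ray (w t), fun t => Q (i + t - 1), ?_, ?_, ?_, ?_⟩
    · exact fun t _ _ => ⟨ax_semiaxis (hwA t), hQ _⟩
    · intro a b ha1 ha2 hb1 hb2 hab
      constructor
      · intro γ hγ h
        have h' : C (w a) (w b) := ⟨γ, hγ, ray_image (hwA a).1 (hwA b).1 h⟩
        have h'' := Ctrans (Ctrans (hwC a) h') (Csymm (hwC b))
        rcases lt_or_gt_of_ne hab with hlt | hlt
        · exact hmin _ _ (by omega) (by omega) h''
        · exact hmin _ _ (by omega) (by omega) (Csymm h'')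
      · intro γ hγ h
        rcases lt_or_gt_of_ne hab with hlt | hlt
        · exact hplanes _ _ (by omega) (by omega) (by omega) γ hγ h
        · obtain ⟨δ, hδ, h'⟩ := hmapsymm hγ h
          exact hplanes _ _ (by omega) (by omega) (by omega) δ hδ h'
    · intro j hj2 hjd
      obtain ⟨k, rfl⟩ : ∃ k, j = k + 2 := ⟨j - 2, by omega⟩
      have e1 : i + (k + 2 - 1) - 1 = i + k := by omega
      have e2 : i + (k + 2) - 1 = i + k + 1 := by omega
      simp only [e1, e2, hwt (k + 2) (by omega)]
      exact ⟨finrank_inter (hQ _).1 (hQ _).1 (hs2 _).symm (hne0 _ (hv (i + k + 1))) (hs1 _) (hvQ _),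
        ray_sub (Submodule.mem_inf.2 ⟨hs1 _, hvQ _⟩)⟩
    · obtain ⟨γ, hγ, hγi⟩ := hi
      obtain ⟨k, rfl⟩ : ∃ k, d = k + 1 := ⟨d - 1, by omega⟩
      have e1 : i + (k + 1) - 1 = i + k := by omega
      have e2 : i + 1 - 1 = i := by omega
      simp only [e1, e2, hw1]
      have m1 : v (i + (k + 1)) ∈ Q (i + k) := hs1 (i + k)
      have m2 : v (i + (k + 1)) ∈ (Q i).map (γ.toLinearEquiv : Vn n →ₗ[ℝ] Vn n) :=
        ⟨v i, hvQ i, hγi⟩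
      exact ⟨γ, hγ, finrank_inter (hQ _).1 ((finrank_map_on γ _).trans (hQ i).1)
        (hplanes i (i + k) le_rfl (by omega) (by omega) γ hγ).symm (hne0 _ (hv _)) m1 m2,
        ray_sub (Submodule.mem_inf.2 ⟨m1, m2⟩)⟩

end
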